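/- Let S = ((a_1,b_1),…,(a_n,b_n)) be a sequence of pairs of nonnegative integers with ∑_{i=1}^n a_i = ∑_{i=1}^n b_i and a_1 ≥ a_2 ≥ … ≥ a_n. If for every k ∈ {1,…,n} one has ∑_{i=1}^{k} min(b_i, k−1) + ∑_{i=k+1}^{n} min(b_i, k) ≥ ∑_{i=1}^{k} a_i, then S is a digraph sequence. -/

import Mathlib

/-- `S = ((a i, b i))_{i}` is a digraph sequence: there is a digraph (no loops,
no parallel arcs; opposite arcs allowed), given by its boolean adjacency matrix `G`,
in which vertex `v i` has indegree `a i` and outdegree `b i`. -/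
def IsDigraphSeq {n : ℕ} (a b : Fin n → ℕ) : Prop :=
  ∃ G : Fin n → Fin n → Bool,
    (∀ i, G i i = false) ∧
    (∀ i, (Finset.univ.filter (fun j => G j i = true)).card = a i) ∧
    (∀ i, (Finset.univ.filter (fun j => G i j = true)).card = b i)

/-- A finite form of max-flow min-cut for digraphs: if the sums agree and every set `A` of
vertices can receive the arcs it demands, then `(a, b)` is a digraph sequence. -/
theorem isDigraphSeq_of_forall_sum_le {n : ℕ} (a b : Fin n → ℕ)
    (hsum : ∑ i, a i = ∑ i, b i)
    (h : ∀ A : Finset (Fin n), ∑ i ∈ A, a i ≤ ∑ i, min (b i) (A.erase i).card) :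
    IsDigraphSeq a b := by
  classical
  -- Each vertex `j` asks for `a j` slots in column `j` (arcs), and each vertex `i` asks for
  -- `n - 1 - b i` slots in row `i` (non-arcs); Hall's theorem assigns distinct slots.
  let t : (Σ j : Fin n, Fin (a j)) ⊕ (Σ i : Fin n, Fin (n - 1 - b i)) →
      Finset (Fin n × Fin n) :=
    Sum.elim (fun x => Finset.univ.filter fun e => e.1 ≠ e.2 ∧ e.2 = x.1)
      (fun x => Finset.univ.filter fun e => e.1 ≠ e.2 ∧ e.1 = x.1)
  have hall : ∀ s : Finset _, s.card ≤ (s.biUnion t).card := by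
    intro s
    let A : Finset (Fin n) := s.toLeft.image Sigma.fst
    let B : Finset (Fin n) := s.toRight.image Sigma.fst
    have hA : s.toLeft.card ≤ ∑ i ∈ A, a i := by
      calc s.toLeft.card ≤ (A.sigma fun j => (Finset.univ : Finset (Fin (a j)))).card := by
            refine Finset.card_le_card fun x hx => ?_
            exact Finset.mem_sigma.2 ⟨Finset.mem_image_of_mem Sigma.fst hx, Finset.mem_univ _⟩
        _ = _ := by simp
    have hB : s.toRight.card ≤ ∑ i ∈ B, (n - 1 - b i) := by
      calc s.toRight.card
          ≤ (B.sigma fun i => (Finset.univ : Finset (Fin (n - 1 - b i)))).card := by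
            refine Finset.card_le_card fun x hx => ?_
            exact Finset.mem_sigma.2 ⟨Finset.mem_image_of_mem Sigma.fst hx, Finset.mem_univ _⟩
        _ = _ := by simp
    let N : Finset (Σ _ : Fin n, Fin n) :=
      Finset.univ.sigma fun i => if i ∈ B then Finset.univ.erase i else A.erase i
    have hN : N.card ≤ (s.biUnion t).card := by
      refine Finset.card_le_card_of_injOn (fun x => (x.1, x.2)) ?_ ?_
      · rintro ⟨i, j⟩ hx
        simp only [N, Finset.coe_sigma, Set.mem_sigma_iff, Finset.mem_coe] at hx
        simp only [Finset.coe_biUnion, Set.mem_iUnion, Finset.mem_coe]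
        by_cases hi : i ∈ B
        · obtain ⟨x, hxs, rfl⟩ := Finset.mem_image.1 hi
          refine ⟨Sum.inr x, Finset.mem_toRight.1 hxs, ?_⟩
          simpa [t, hi, eq_comm] using hx
        · simp only [hi, if_false, Finset.mem_erase] at hx
          obtain ⟨x, hxs, rfl⟩ := Finset.mem_image.1 hx.2.2
          refine ⟨Sum.inl x, Finset.mem_toLeft.1 hxs, ?_⟩
          simpa [t, eq_comm] using hx.2.1
      · rintro ⟨i, j⟩ _ ⟨i', j'⟩ _ hij
        simp only [Prod.mk.injEq] at hij
        obtain ⟨rfl, rfl⟩ := hij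
        rfl
    have hcount : ∑ i, min (b i) (A.erase i).card + ∑ i ∈ B, (n - 1 - b i) ≤ N.card := by
      rw [Finset.card_sigma, ← Finset.sum_filter_add_sum_filter_not Finset.univ (· ∈ B)
        (fun i => min (b i) (A.erase i).card), ← Finset.sum_filter_add_sum_filter_not
        Finset.univ (· ∈ B) (fun i => (if i ∈ B then Finset.univ.erase i else A.erase i).card),
        add_right_comm, Finset.filter_univ_mem, ← Finset.sum_add_distrib]
      refine add_le_add (Finset.sum_le_sum fun i hi => ?_) (Finset.sum_le_sum fun i hi => ?_)
      · have := Finset.card_le_card (Finset.erase_subset_erase i (Finset.subset_univ A))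
        simp only [hi, if_true]
        simp only [Finset.card_erase_of_mem (Finset.mem_univ i), Finset.card_univ,
          Fintype.card_fin] at this ⊢
        omega
      · simp [(Finset.mem_filter.1 hi).2]
    have := h A
    have := Finset.card_toLeft_add_card_toRight (u := s)
    omega
  obtain ⟨f, hf, hft⟩ := (Finset.all_card_le_biUnion_card_iff_exists_injective t).1 hall
  have hl : ∀ x, (f (Sum.inl x)).1 ≠ (f (Sum.inl x)).2 ∧ (f (Sum.inl x)).2 = x.1 := fun x => by
    simpa [t] using hft (Sum.inl x)
  have hr : ∀ x, (f (Sum.inr x)).1 ≠ (f (Sum.inr x)).2 ∧ (f (Sum.inr x)).1 = x.1 := fun x => by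
    simpa [t] using hft (Sum.inr x)
  let G : Fin n → Fin n → Bool := fun i j => decide (∃ x, f (Sum.inl x) = (i, j))
  have hin : ∀ j, (Finset.univ.filter fun i => G i j = true).card = a j := by
    intro j
    have : (Finset.univ.filter fun i => G i j = true) =
        Finset.univ.image fun u : Fin (a j) => (f (Sum.inl ⟨j, u⟩)).1 := by
      ext i
      simp only [G, Finset.mem_filter, Finset.mem_univ, true_and, decide_eq_true_eq,
        Finset.mem_image]
      constructor
      · rintro ⟨⟨j', u⟩, hx⟩
        have := (hl ⟨j', u⟩).2
        rw [hx] at this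
        obtain rfl : j = j' := this
        exact ⟨u, by rw [hx]⟩
      · rintro ⟨u, rfl⟩
        exact ⟨⟨j, u⟩, Prod.ext rfl (hl _).2⟩
    rw [this, Finset.card_image_of_injective, Finset.card_univ, Fintype.card_fin]
    intro u v huv
    have := hf (Prod.ext huv ((hl ⟨j, u⟩).2.trans (hl ⟨j, v⟩).2.symm))
    simpa using this
  have hloop : ∀ i, G i i = false := by
    intro i
    simp only [G, decide_eq_false_iff_not, not_exists]
    intro x hx
    apply (hl x).1
    rw [hx]
  have hout_le : ∀ i, (Finset.univ.filter fun j => G i j = true).card ≤ b i := by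
    intro i
    let R : Finset (Fin n) := Finset.univ.image fun u : Fin (n - 1 - b i) => (f (Sum.inr ⟨i, u⟩)).2
    have hR : R.card = n - 1 - b i := by
      rw [Finset.card_image_of_injective, Finset.card_univ, Fintype.card_fin]
      intro u v huv
      have := hf (Prod.ext ((hr ⟨i, u⟩).2.trans (hr ⟨i, v⟩).2.symm) huv)
      simpa using this
    have hdisj : Disjoint (Finset.univ.filter fun j => G i j = true) R := by
      rw [Finset.disjoint_left]
      intro j hj hjR
      simp only [G, Finset.mem_filter, Finset.mem_univ, true_and, decide_eq_true_eq] at hj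
      obtain ⟨x, hx⟩ := hj
      obtain ⟨u, -, hu⟩ := Finset.mem_image.1 hjR
      have : f (Sum.inl x) = f (Sum.inr ⟨i, u⟩) := by
        rw [hx]
        exact Prod.ext (hr ⟨i, u⟩).2.symm hu.symm
      exact absurd (hf this) (by simp)
    have hsub : (Finset.univ.filter fun j => G i j = true) ∪ R ⊆ Finset.univ.erase i := by
      intro j hj
      refine Finset.mem_erase.2 ⟨?_, Finset.mem_univ j⟩
      rintro rfl
      rcases Finset.mem_union.1 hj with hj | hj
      · simp [hloop] at hj
      · obtain ⟨u, -, hu⟩ := Finset.mem_image.1 hj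
        exact (hr ⟨j, u⟩).1 ((hr ⟨j, u⟩).2.trans hu.symm)
    have := Finset.card_le_card hsub
    rw [Finset.card_union_of_disjoint hdisj, hR, Finset.card_erase_of_mem (Finset.mem_univ i),
      Finset.card_univ, Fintype.card_fin] at this
    omega
  have hswap : ∑ i, (Finset.univ.filter fun j => G i j = true).card = ∑ i, b i := by
    rw [← hsum, ← Finset.sum_congr rfl fun j _ => hin j]
    exact Finset.sum_card_bipartiteAbove_eq_sum_card_bipartiteBelow (fun i j => G i j = true)
  refine ⟨G, hloop, hin, fun i => ?_⟩
  exact (Finset.sum_eq_sum_iff_of_le fun i _ => hout_le i).1 hswap i (Finset.mem_univ i)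

/-- A downward closed predicate on `Fin n` cuts out an initial segment. -/
theorem exists_le_forall_val_lt_iff {n : ℕ} (P : Fin n → Prop)
    (hP : ∀ i j, i ≤ j → P j → P i) : ∃ p ≤ n, ∀ i : Fin n, (i : ℕ) < p ↔ P i := by
  classical
  have hex : ∃ p, ∀ i : Fin n, P i → (i : ℕ) < p := ⟨n, fun i _ => i.2⟩
  have hle : Nat.find hex ≤ n := Nat.find_min' hex fun i _ => i.2
  refine ⟨Nat.find hex, hle, fun i => ⟨fun hi => ?_, Nat.find_spec hex i⟩⟩
  have := Nat.find_min hex hi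
  push Not at this
  obtain ⟨j, hj, hij⟩ := this
  exact hP i j hij hj

/-- If `a` is decreasing, the inequalities for initial segments imply those for all sets. -/
theorem sum_le_sum_min_card_erase {n : ℕ} (a b : Fin n → ℕ)
    (hdec : ∀ i j : Fin n, i ≤ j → a j ≤ a i)
    (hineq : ∀ k : ℕ, 1 ≤ k → k ≤ n →
      (∑ i : Fin n, if (i : ℕ) < k then a i else 0) ≤
        ∑ i : Fin n, (if (i : ℕ) < k then min (b i) (k - 1) else min (b i) k))
    (A : Finset (Fin n)) : ∑ i ∈ A, a i ≤ ∑ i, min (b i) (A.erase i).card := by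
  classical
  obtain hA | hA := A.eq_empty_or_nonempty
  · simp [hA]
  set k := A.card with hk
  have hk0 : 0 < k := hA.card_pos
  have hkn : k ≤ n := by simpa using Finset.card_le_univ A
  have hseg : ∀ m ≤ n, (∑ i : Fin n, if (i : ℕ) < m then (a i : ℤ) else 0) +
      (∑ i : Fin n, if (i : ℕ) < m ∧ m ≤ b i then 1 else 0) ≤
        ∑ i, min (b i : ℤ) m := by
    intro m hm
    obtain rfl | hm0 := Nat.eq_zero_or_pos m
    · simp
    have h := Int.ofNat_le.2 (hineq m hm0 hm)
    have : ∑ i : Fin n, ((if (i : ℕ) < m then min (b i) (m - 1) else min (b i) m : ℕ) : ℤ) +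
        (∑ i : Fin n, if (i : ℕ) < m ∧ m ≤ b i then 1 else 0) = ∑ i, min (b i : ℤ) m := by
      rw [← Finset.sum_add_distrib]
      refine Finset.sum_congr rfl fun i _ => ?_
      split_ifs <;> omega
    push_cast at h this
    linarith
  have hcardlt : ∀ m ≤ n, ∀ x : ℤ, (∑ i : Fin n, if (i : ℕ) < m then x else 0) = m * x := by
    intro m hm x
    rw [← Finset.sum_filter, Finset.sum_const, Fin.card_filter_val_lt, min_eq_right hm,
      nsmul_eq_mul]
  have hcardA : ∀ x : ℤ, (∑ i : Fin n, if i ∈ A then x else 0) = k * x := by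
    intro x
    simp [hk]
  suffices (∑ i, if i ∈ A then (a i : ℤ) else 0) + (∑ i, if i ∈ A ∧ k ≤ b i then 1 else 0) ≤
      ∑ i, min (b i : ℤ) k by
    have herase : ∑ i, ((min (b i) (A.erase i).card : ℕ) : ℤ) +
        (∑ i, if i ∈ A ∧ k ≤ b i then 1 else 0) = ∑ i, min (b i : ℤ) k := by
      rw [← Finset.sum_add_distrib]
      refine Finset.sum_congr rfl fun i _ => ?_
      by_cases hi : i ∈ A
      · rw [Finset.card_erase_of_mem hi, ← hk]
        simp only [hi, true_and]
        split_ifs <;> omega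
      · rw [Finset.erase_eq_of_notMem hi, ← hk]
        simp [hi]
    zify
    rw [← Finset.sum_filter, Finset.filter_univ_mem] at this
    push_cast at herase
    linarith
  let l : Fin n := ⟨k - 1, by omega⟩
  set c : ℤ := (a l : ℤ)
  set N : ℤ := ∑ i, if k ≤ b i then 1 else 0 with hN
  obtain hNc | hNc := le_or_gt N c
  · obtain ⟨q, hqn, hq⟩ := exists_le_forall_val_lt_iff (fun i => c ≤ a i) fun i j hij hj => by
      have := hdec i j hij
      omega
    have hkq : k ≤ q := by
      have := (hq l).2 le_rfl
      simp only [l] at this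
      omega
    have hb : ∑ i, min (b i : ℤ) q + (∑ i : Fin n, if (i : ℕ) < q ∧ k ≤ b i then 1 else 0) ≤
        ∑ i, min (b i : ℤ) k + (q - k) * N +
          (∑ i : Fin n, if (i : ℕ) < q ∧ q ≤ b i then 1 else 0) := by
      rw [hN, Finset.mul_sum]
      simp only [← Finset.sum_add_distrib]
      refine Finset.sum_le_sum fun i _ => ?_
      split_ifs <;> omega
    have ha : (∑ i, if i ∈ A then (a i : ℤ) else 0) - (∑ i, if i ∈ A then c else 0) +
        (∑ i, if i ∈ A ∧ k ≤ b i then 1 else 0) ≤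
        (∑ i : Fin n, if (i : ℕ) < q then (a i : ℤ) else 0) -
          (∑ i : Fin n, if (i : ℕ) < q then c else 0) +
          (∑ i : Fin n, if (i : ℕ) < q ∧ k ≤ b i then 1 else 0) := by
      simp only [← Finset.sum_add_distrib, ← Finset.sum_sub_distrib]
      refine Finset.sum_le_sum fun i _ => ?_
      have := hq i
      split_ifs <;> grind
    rw [hcardA, hcardlt q hqn] at ha
    have := hseg q hqn
    have : ((q : ℤ) - k) * N ≤ (q - k) * c := mul_le_mul_of_nonneg_left hNc (by omega)
    linarith
  · obtain ⟨p, hpn, hp⟩ := exists_le_forall_val_lt_iff (fun i => c < a i) fun i j hij hj => by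
      have := hdec i j hij
      omega
    have hpk : p ≤ k := by
      have := mt (hp l).1 (lt_irrefl c)
      simp only [l] at this
      omega
    have hb : ∑ i, min (b i : ℤ) p + (k - p) * N ≤ ∑ i, min (b i : ℤ) k := by
      rw [hN, Finset.mul_sum]
      simp only [← Finset.sum_add_distrib]
      refine Finset.sum_le_sum fun i _ => ?_
      split_ifs <;> omega
    have ha : (∑ i, if i ∈ A then (a i : ℤ) else 0) - (∑ i, if i ∈ A then c + 1 else 0) +
        (∑ i, if i ∈ A ∧ k ≤ b i then 1 else 0) ≤
        (∑ i : Fin n, if (i : ℕ) < p then (a i : ℤ) else 0) -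
          (∑ i : Fin n, if (i : ℕ) < p then c + 1 else 0) +
          (∑ i : Fin n, if (i : ℕ) < p ∧ p ≤ b i then 1 else 0) := by
      simp only [← Finset.sum_add_distrib, ← Finset.sum_sub_distrib]
      refine Finset.sum_le_sum fun i _ => ?_
      have := hp i
      split_ifs <;> grind
    rw [hcardA, hcardlt p hpn] at ha
    have := hseg p hpn
    have : ((k : ℤ) - p) * (c + 1) ≤ (k - p) * N :=
      mul_le_mul_of_nonneg_left (by omega) (by omega)
    linarith

/-- Sufficiency of the Fulkerson–Chen inequalities for sequences whose first
components are sorted decreasingly (not necessarily lexicographically): if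
`∑_{i=1}^{k} min(b i, k-1) + ∑_{i=k+1}^{n} min(b i, k) ≥ ∑_{i=1}^{k} a i` for every
`k ∈ {1,…,n}`, then `S` is a digraph sequence. -/
theorem digraph_seq_of_fulkerson_chen {n : ℕ} (a b : Fin n → ℕ)
    (hsum : ∑ i, a i = ∑ i, b i)
    (hdec : ∀ i j : Fin n, i ≤ j → a j ≤ a i)
    (hineq : ∀ k : ℕ, 1 ≤ k → k ≤ n →
      (∑ i : Fin n, if (i : ℕ) < k then a i else 0) ≤
        ∑ i : Fin n, (if (i : ℕ) < k then min (b i) (k - 1) else min (b i) k)) :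
    IsDigraphSeq a b := by
  exact isDigraphSeq_of_forall_sum_le a b hsum (sum_le_sum_min_card_erase a b hdec hineq)
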